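/- arXiv:1910.10346 — 4 statements merged into one kernel-verified Lean document; each statement's English description precedes it below -/
import Mathlib

section
/- Stratum-by-stratum computation of the least fixed point is correct: let P₁ and P₂ be sets of ground negation-free rules over α and S : Set α be such that every conclusion of a rule in P₁ lies in S, every atom occurring in a body of a rule in P₁ lies in S, and no conclusion of a rule in P₂ lies in S. Then (i) (lfp T_{P₁ ∪ P₂}) ∩ S = lfp T_{P₁}, and (ii) lfp T_{P₁ ∪ P₂} = lfp T_{P₂ ∪ F}, where F = {(∅, a) | a ∈ lfp T_{P₁}} is the set of facts asserting the atoms of lfp T_{P₁}. -/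
/-- The one-step derivability operator for a set `P` of ground negation-free
rules, bundled as a monotone map. A rule is a pair `(B, h)` with body
`B : Set α` and conclusion `h : α`. -/
def TPhom {α : Type*} (P : Set (Set α × α)) : Set α →o Set α where
  toFun I := {h | ∃ B, (B, h) ∈ P ∧ B ⊆ I}
  monotone' := by
    rintro I J hIJ x ⟨B, hB, hBI⟩
    exact ⟨B, hB, hBI.trans hIJ⟩

theorem lfp_closed_aux {α : Type*} (P : Set (Set α × α)) {B : Set α} {h : α}
    (hr : (B, h) ∈ P) (hB : B ⊆ OrderHom.lfp (TPhom P)) : h ∈ OrderHom.lfp (TPhom P) := by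
  rw [← OrderHom.map_lfp]
  exact ⟨B, hr, hB⟩

theorem lfp_ind_aux {α : Type*} (P : Set (Set α × α)) (X : Set α)
    (hX : ∀ B h, (B, h) ∈ P → B ⊆ X → h ∈ X) : OrderHom.lfp (TPhom P) ⊆ X := by
  apply OrderHom.lfp_le
  rintro h ⟨B, hr, hB⟩
  exact hX B h hr hB

theorem lfp_by_stratum {α : Type*} (P₁ P₂ : Set (Set α × α)) (S : Set α)
    (hconcl₁ : ∀ r ∈ P₁, r.2 ∈ S)
    (hbody₁ : ∀ r ∈ P₁, r.1 ⊆ S)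
    (hconcl₂ : ∀ r ∈ P₂, r.2 ∉ S) :
    OrderHom.lfp (TPhom (P₁ ∪ P₂)) ∩ S = OrderHom.lfp (TPhom P₁) ∧
    OrderHom.lfp (TPhom (P₁ ∪ P₂)) =
      OrderHom.lfp (TPhom (P₂ ∪
        {r : Set α × α | r.1 = ∅ ∧ r.2 ∈ OrderHom.lfp (TPhom P₁)})) := by
  have h1L : OrderHom.lfp (TPhom P₁) ⊆ OrderHom.lfp (TPhom (P₁ ∪ P₂)) :=
    lfp_ind_aux _ _ fun B h hr hB => lfp_closed_aux _ (Or.inl hr) hB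
  have h1S : OrderHom.lfp (TPhom P₁) ⊆ S :=
    lfp_ind_aux _ _ fun B h hr _ => hconcl₁ _ hr
  have hL : OrderHom.lfp (TPhom (P₁ ∪ P₂)) ⊆ {x | x ∈ S → x ∈ OrderHom.lfp (TPhom P₁)} := by
    refine lfp_ind_aux _ _ ?_
    rintro B h (hr | hr) hB hS
    · exact lfp_closed_aux _ hr fun b hb => hB hb (hbody₁ _ hr hb)
    · exact absurd hS (hconcl₂ _ hr)
  refine ⟨Set.Subset.antisymm (fun x hx => hL hx.1 hx.2) fun x hx => ⟨h1L hx, h1S hx⟩, ?_⟩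
  apply Set.Subset.antisymm
  · have hM : OrderHom.lfp (TPhom (P₂ ∪
        {r : Set α × α | r.1 = ∅ ∧ r.2 ∈ OrderHom.lfp (TPhom P₁)})) ⊆
        {x | x ∈ S → x ∈ OrderHom.lfp (TPhom P₁)} := by
      refine lfp_ind_aux _ _ ?_
      rintro B h (hr | hr) hB hS
      · exact absurd hS (hconcl₂ _ hr)
      · exact hr.2
    refine lfp_ind_aux _ _ ?_
    rintro B h (hr | hr) hB
    · have h1 : h ∈ OrderHom.lfp (TPhom P₁) :=
        lfp_closed_aux _ hr fun b hb => hM (hB hb) (hbody₁ _ hr hb)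
      exact lfp_closed_aux _ (B := ∅) (Or.inr ⟨rfl, h1⟩) (Set.empty_subset _)
    · exact lfp_closed_aux _ (Or.inl hr) hB
  · refine lfp_ind_aux _ _ ?_
    rintro B h (hr | hr) hB
    · exact lfp_closed_aux _ (Or.inr hr) hB
    · exact h1L hr.2
end

section
/- Every 2-valued model of the win rule's completion extends the founded model: if w : α → Prop satisfies ∀ x, w x ↔ (∃ y, move x y ∧ ¬ w y), then w x holds for every x ∈ Win and ¬ w x holds for every x ∈ Lose, where (Win, Lose) is the least fixed point of the win–lose operator Φ. -/
/-- The win–lose operator for a game with moves `move`, bundled as a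
monotone map on the complete lattice `Set α × Set α` (componentwise
inclusion). -/
def winLose {α : Type*} (move : α → α → Prop) :
    Set α × Set α →o Set α × Set α where
  toFun p := ({x | ∃ y, move x y ∧ y ∈ p.2}, {x | ∀ y, move x y → y ∈ p.1})
  monotone' := by
    intro p q h
    constructor
    · rintro x ⟨y, hm, hy⟩
      exact ⟨y, hm, h.2 hy⟩
    · intro x hx y hm
      exact h.1 (hx y hm)

/-- The founded winning set: first component of the least fixed point. -/
def Win {α : Type*} (move : α → α → Prop) : Set α :=
  (OrderHom.lfp (winLose move)).1

/-- The founded losing set: second component of the least fixed point. -/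
def Lose {α : Type*} (move : α → α → Prop) : Set α :=
  (OrderHom.lfp (winLose move)).2

theorem model_extends_founded {α : Type*} (move : α → α → Prop)
    (w : α → Prop) (hw : ∀ x, w x ↔ ∃ y, move x y ∧ ¬ w y) :
    (∀ x ∈ Win move, w x) ∧ (∀ x ∈ Lose move, ¬ w x) := by
  have h : OrderHom.lfp (winLose move) ≤ ({x | w x}, {x | ¬ w x}) := by
    apply OrderHom.lfp_le
    constructor
    · rintro x ⟨y, hm, hy⟩
      exact (hw x).2 ⟨y, hm, hy⟩
    · intro x hx hwx
      obtain ⟨y, hm, hy⟩ := (hw x).1 hwx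
      exact hy (hx y hm)
  exact ⟨fun x hx => h.1 hx, fun x hx => h.2 hx⟩
end

section
/- If the relation (fun y x => move x y) is well-founded, then the win rule's completion has exactly one 2-valued model, namely the founded one: a predicate w : α → Prop satisfies ∀ x, w x ↔ (∃ y, move x y ∧ ¬ w y) if and only if ∀ x, w x ↔ x ∈ Win, where (Win, Lose) is the least fixed point of the win–lose operator Φ. -/
theorem wellFounded_unique_model {α : Type*} (move : α → α → Prop)
    (hwf : WellFounded (fun y x => move x y)) (w : α → Prop) :
    (∀ x, w x ↔ ∃ y, move x y ∧ ¬ w y) ↔ (∀ x, w x ↔ x ∈ Win move) := by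
  have hfix := (winLose move).map_lfp
  have hW : ∀ x, x ∈ Win move ↔ ∃ y, move x y ∧ y ∈ Lose move := by
    intro x
    have h := congrArg (fun p : Set α × Set α => x ∈ p.1) hfix
    exact (iff_of_eq h).symm
  have hL : ∀ x, x ∈ Lose move ↔ ∀ y, move x y → y ∈ Win move := by
    intro x
    have h := congrArg (fun p : Set α × Set α => x ∈ p.2) hfix
    exact (iff_of_eq h).symm
  have hC : ∀ x, x ∈ Lose move ↔ x ∉ Win move := by
    intro x
    induction x using hwf.induction with
    | _ x ih =>
      rw [hL, hW]
      constructor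
      · rintro h ⟨y, hm, hy⟩
        exact (ih y hm).1 hy (h y hm)
      · intro h y hm
        by_contra hy
        exact h ⟨y, hm, (ih y hm).2 hy⟩
  constructor
  · intro h x
    induction x using hwf.induction with
    | _ x ih =>
      rw [h, hW]
      refine exists_congr fun y => and_congr_right fun hm => ?_
      rw [hC, ih y hm]
  · intro h x
    rw [h, hW]
    refine exists_congr fun y => and_congr_right fun _ => ?_
    rw [hC, h]
end

section
/- If the founded model of the win-not-win game is 2-valued, the constraint semantics is the singleton consisting of the founded model: if every position x satisfies x ∈ Win or x ∈ Lose, then a predicate w : α → Prop satisfies ∀ x, w x ↔ (∃ y, move x y ∧ ¬ w y) if and only if ∀ x, w x ↔ x ∈ Win, where (Win, Lose) is the least fixed point of the win–lose operator Φ. -/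
theorem founded_fixed {α : Type*} (move : α → α → Prop) :
    (∀ x, x ∈ Win move ↔ ∃ y, move x y ∧ y ∈ Lose move) ∧
    (∀ x, x ∈ Lose move ↔ ∀ y, move x y → y ∈ Win move) := by
  have h := OrderHom.map_lfp (winLose move)
  have h1 := congrArg Prod.fst h
  have h3 := congrArg Prod.snd h
  exact ⟨fun x => (Set.ext_iff.1 h1 x).symm, fun x => (Set.ext_iff.1 h3 x).symm⟩

theorem founded_least {α : Type*} (move : α → α → Prop) (A B : Set α)
    (hA : ∀ x, (∃ y, move x y ∧ y ∈ B) → x ∈ A)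
    (hB : ∀ x, (∀ y, move x y → y ∈ A) → x ∈ B) :
    Win move ⊆ A ∧ Lose move ⊆ B := by
  have h : OrderHom.lfp (winLose move) ≤ (A, B) :=
    OrderHom.lfp_le (winLose move) ⟨hA, hB⟩
  exact ⟨h.1, h.2⟩

theorem founded_disjoint {α : Type*} (move : α → α → Prop) (x : α)
    (hW : x ∈ Win move) (hL : x ∈ Lose move) : False := by
  obtain ⟨f1, f2⟩ := founded_fixed move
  have h := founded_least move (Lose move)ᶜ (Win move)ᶜ
    (by rintro x ⟨y, hm, hy⟩ hx
        exact hy ((f2 x).1 hx y hm))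
    (by intro x hx hw
        obtain ⟨y, hm, hy⟩ := (f1 x).1 hw
        exact hx y hm hy)
  exact h.1 hW hL

theorem twoValued_founded_unique_model {α : Type*} (move : α → α → Prop)
    (h2 : ∀ x : α, x ∈ Win move ∨ x ∈ Lose move) (w : α → Prop) :
    (∀ x, w x ↔ ∃ y, move x y ∧ ¬ w y) ↔ (∀ x, w x ↔ x ∈ Win move) := by
  obtain ⟨f1, f2⟩ := founded_fixed move
  constructor
  · intro hw
    have h := founded_least move {x | w x} {x | ¬ w x}
      (fun x hx => (hw x).2 hx)
      (by intro x hx hwx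
          obtain ⟨y, hm, hy⟩ := (hw x).1 hwx
          exact hy (hx y hm))
    intro x
    exact ⟨fun hx => (h2 x).resolve_right (fun hl => h.2 hl hx), fun hx => h.1 hx⟩
  · intro hw x
    rw [hw x, f1 x]
    refine exists_congr fun y => and_congr_right fun _ => ?_
    rw [hw y]
    exact ⟨fun hl hy => founded_disjoint move y hy hl, fun hn => (h2 y).resolve_left hn⟩
end
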